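/- For every ranked alphabet Σ and every k ≥ 1, every tree language over Σ accepted by a nondeterministic k-head tree-walking automaton with nested pebbles is definable in first-order logic with k-ary transitive closure: NPTWA^k ⊆ FO+TC^k. -/

import Mathlib

namespace NestedPebbles

/-- Trees over a ranked alphabet `(Sig, rank)`: terms `σ(t₁,…,tₙ)` with `rank σ = n`. -/
inductive RTree (Sig : Type) (rank : Sig → ℕ) : Type
  | node (a : Sig) (children : Fin (rank a) → RTree Sig rank) : RTree Sig rank

namespace RTree

variable {Sig : Type} {rank : Sig → ℕ}

/-- The label of the root symbol. -/
def label : RTree Sig rank → Sig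
  | node a _ => a

/-- The `i`-th (0-based) immediate subtree, if it exists. -/
def child : RTree Sig rank → ℕ → Option (RTree Sig rank)
  | node a c, i => if h : i < rank a then some (c ⟨i, h⟩) else none

/-- The subtree at a position (a list of 0-based child indices, read from the root). -/
def subtree : RTree Sig rank → List ℕ → Option (RTree Sig rank)
  | t, [] => some t
  | t, i :: p => (t.child i).bind fun s => s.subtree p

end RTree

variable {Sig : Type} {rank : Sig → ℕ}

/-- `p` is (the address of) a node of `t`. -/
def IsPos (t : RTree Sig rank) (p : List ℕ) : Prop := (t.subtree p).isSome = true

/-- The type of nodes of a tree `t`, as valid positions. -/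
def Pos (t : RTree Sig rank) : Type := { p : List ℕ // IsPos t p }

/-- The root node. -/
def rootPos (t : RTree Sig rank) : Pos t := ⟨[], rfl⟩

/-- The label of the node of `t` at position `p`. -/
def labelAt (t : RTree Sig rank) (p : List ℕ) : Option Sig := (t.subtree p).map RTree.label

/-- The child number of a node: `0` for the root, and `j` for a `j`-th child (1-based). -/
def childNo (p : List ℕ) : ℕ :=
  match p.getLast? with
  | none => 0
  | some j => j + 1

/-!  ### First-order logic with k-ary transitive closure, on trees  -/

/-- First-order formulas over a ranked alphabet, with a `k`-ary transitive closure
operator.  Variables are natural numbers.  `lab a x` means `x` has label `a`;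
`edg i x y` means `y` is the `i`-th child of `x` (`i` is 1-based);
`le x y` means `x` is an ancestor of `y`; `tc xs ys φ us vs` is the transitive
closure `φ*` of `φ` with respect to the tuples of variables `xs`, `ys` (which it
binds), applied to the tuples of variables `us`, `vs`. -/
inductive TForm (Sig : Type) (rank : Sig → ℕ) (k : ℕ) : Type
  | lab (a : Sig) (x : ℕ)
  | edg (i : ℕ) (x y : ℕ)
  | le (x y : ℕ)
  | eq (x y : ℕ)
  | not (φ : TForm Sig rank k)
  | and (φ ψ : TForm Sig rank k)
  | or (φ ψ : TForm Sig rank k)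
  | ex (x : ℕ) (φ : TForm Sig rank k)
  | all (x : ℕ) (φ : TForm Sig rank k)
  | tc (xs ys : Fin k → ℕ) (φ : TForm Sig rank k) (us vs : Fin k → ℕ)

/-- Update a valuation on a tuple of variables simultaneously. -/
noncomputable def updVec {α : Type} {k : ℕ} (ν : ℕ → α) (xs : Fin k → ℕ) (a : Fin k → α) :
    ℕ → α :=
  fun n => if h : ∃ i, xs i = n then a h.choose else ν n

/-- Satisfaction of a formula in a tree `t` under a valuation of the variables by
nodes of `t`. -/
def Sat {k : ℕ} (t : RTree Sig rank) : TForm Sig rank k → (ℕ → Pos t) → Prop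
  | .lab a x, ν => labelAt t (ν x).1 = some a
  | .edg i x y, ν => 1 ≤ i ∧ (ν y).1 = (ν x).1 ++ [i - 1]
  | .le x y, ν => (ν x).1 <+: (ν y).1
  | .eq x y, ν => ν x = ν y
  | .not φ, ν => ¬ Sat t φ ν
  | .and φ ψ, ν => Sat t φ ν ∧ Sat t ψ ν
  | .or φ ψ, ν => Sat t φ ν ∨ Sat t ψ ν
  | .ex x φ, ν => ∃ u : Pos t, Sat t φ (Function.update ν x u)
  | .all x φ, ν => ∀ u : Pos t, Sat t φ (Function.update ν x u)
  | .tc xs ys φ us vs, ν =>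
      Relation.ReflTransGen
        (fun a b : Fin k → Pos t => Sat t φ (updVec (updVec ν xs a) ys b))
        (fun i => ν (us i)) (fun i => ν (vs i))

/-- The free variables of a formula. -/
def freeVars {k : ℕ} : TForm Sig rank k → Set ℕ
  | .lab _ x => {x}
  | .edg _ x y => {x, y}
  | .le x y => {x, y}
  | .eq x y => {x, y}
  | .not φ => freeVars φ
  | .and φ ψ => freeVars φ ∪ freeVars ψ
  | .or φ ψ => freeVars φ ∪ freeVars ψ
  | .ex x φ => freeVars φ \ {x}
  | .all x φ => freeVars φ \ {x}
  | .tc xs ys φ us vs =>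
      (freeVars φ \ (Set.range xs ∪ Set.range ys)) ∪ Set.range us ∪ Set.range vs

/-- Two `k`-tuples of variables consist of `2k` pairwise distinct variables. -/
def Distinct2 {k : ℕ} (xs ys : Fin k → ℕ) : Prop :=
  Function.Injective xs ∧ Function.Injective ys ∧ ∀ i j, xs i ≠ ys j

/-- `φ` is functional in the tuples of variables `xs`, `ys`: for every tree, every
valuation of the remaining variables, and every value of `xs`, there is at most one
value of `ys` satisfying `φ`. -/
def FunctionalIn {k : ℕ} (φ : TForm Sig rank k) (xs ys : Fin k → ℕ) : Prop :=
  ∀ (t : RTree Sig rank) (ν : ℕ → Pos t) (a b b' : Fin k → Pos t),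
    Sat t φ (updVec (updVec ν xs a) ys b) →
    Sat t φ (updVec (updVec ν xs a) ys b') → b = b'

/-- Well-formedness: in each transitive closure the `2k` bound variables are
pairwise distinct and occur free in the body. -/
def WF {k : ℕ} : TForm Sig rank k → Prop
  | .not φ => WF φ
  | .and φ ψ => WF φ ∧ WF ψ
  | .or φ ψ => WF φ ∧ WF ψ
  | .ex _ φ => WF φ
  | .all _ φ => WF φ
  | .tc xs ys φ _ _ =>
      Distinct2 xs ys ∧ (Set.range xs ∪ Set.range ys) ⊆ freeVars φ ∧ WF φ
  | _ => True

/-- All transitive closures occurring in the formula are deterministic, i.e., applied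
to functional formulas. -/
def DetTC {k : ℕ} : TForm Sig rank k → Prop
  | .not φ => DetTC φ
  | .and φ ψ => DetTC φ ∧ DetTC ψ
  | .or φ ψ => DetTC φ ∧ DetTC ψ
  | .ex _ φ => DetTC φ
  | .all _ φ => DetTC φ
  | .tc xs ys φ _ _ => FunctionalIn φ xs ys ∧ DetTC φ
  | _ => True

/-- All occurrences of transitive closure are positive (within the scope of an even
number of negations); the polarity parameter `b` is `true` for an even number. -/
def PosTC {k : ℕ} : Bool → TForm Sig rank k → Prop
  | b, .not φ => PosTC (!b) φ
  | b, .and φ ψ => PosTC b φ ∧ PosTC b ψ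
  | b, .or φ ψ => PosTC b φ ∧ PosTC b ψ
  | b, .ex _ φ => PosTC b φ
  | b, .all _ φ => PosTC b φ
  | b, .tc _ _ φ _ _ => b = true ∧ PosTC b φ
  | _, _ => True

/-- The formula contains no transitive closure operator (pure first-order). -/
def TCFree {k : ℕ} : TForm Sig rank k → Prop
  | .not φ => TCFree φ
  | .and φ ψ => TCFree φ ∧ TCFree ψ
  | .or φ ψ => TCFree φ ∧ TCFree ψ
  | .ex _ φ => TCFree φ
  | .all _ φ => TCFree φ
  | .tc _ _ _ _ _ => False
  | _ => True

/-- The tree language defined by a (closed) formula. -/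
def treesOf {k : ℕ} (φ : TForm Sig rank k) : Set (RTree Sig rank) :=
  {t | Sat t φ fun _ => rootPos t}

/-- `FO+DTC^k`: tree languages definable by closed first-order formulas with `k`-ary
deterministic transitive closure. -/
def FODTC (Sig : Type) (rank : Sig → ℕ) (k : ℕ) : Set (Set (RTree Sig rank)) :=
  {L | ∃ φ : TForm Sig rank k, WF φ ∧ DetTC φ ∧ freeVars φ = ∅ ∧ L = treesOf φ}

/-- `FO+TC^k`: tree languages definable by closed first-order formulas with `k`-ary
transitive closure. -/
def FOTC (Sig : Type) (rank : Sig → ℕ) (k : ℕ) : Set (Set (RTree Sig rank)) :=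
  {L | ∃ φ : TForm Sig rank k, WF φ ∧ freeVars φ = ∅ ∧ L = treesOf φ}

/-- `FO+posTC^k`: tree languages definable by closed first-order formulas in which
every occurrence of the `k`-ary transitive closure operator is positive. -/
def FOposTC (Sig : Type) (rank : Sig → ℕ) (k : ℕ) : Set (Set (RTree Sig rank)) :=
  {L | ∃ φ : TForm Sig rank k, WF φ ∧ PosTC true φ ∧ freeVars φ = ∅ ∧ L = treesOf φ}

/-!  ### k-head tree-walking automata with nested pebbles  -/

/-- Tests of a `k`-head tree-walking automaton with pebble set `X`:
label of the node under head `i`, presence of pebble `x` at head `i`, and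
child number of the node under head `i`. -/
inductive TTest (Sig : Type) (k : ℕ) (X : Type) : Type
  | lab (i : Fin k) (a : Sig)
  | peb (i : Fin k) (x : X)
  | chno (i : Fin k) (j : ℕ)

/-- Instructions: move head `i` up / down to the `j`-th child (1-based), drop a
pebble at head `i`, retrieve the most recently dropped pebble (from a distance),
or perform a positive (`b = true`) or negated (`b = false`) test. -/
inductive TInstr (Sig : Type) (k : ℕ) (X : Type) : Type
  | up (i : Fin k)
  | down (i : Fin k) (j : ℕ)
  | dropPeb (i : Fin k) (x : X)
  | retrieve (x : X)
  | test (b : Bool) (τ : TTest Sig k X)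

/-- A `k`-head tree-walking automaton with nested pebbles: a finite state set `Q`,
a finite pebble set `X`, an initial state, accepting states, and a finite set of
instructions `⟨p, χ, q⟩`. -/
structure TWA (Sig : Type) (rank : Sig → ℕ) (k : ℕ) : Type 1 where
  Q : Type
  finQ : Fintype Q
  X : Type
  finX : Fintype X
  q0 : Q
  acc : Set Q
  instr : Set (Q × TInstr Sig k X × Q)
  instrFin : instr.Finite

/-- Configurations: a state, the positions of the `k` heads, and the stack of
dropped pebbles with their positions (most recent first). -/
abbrev TConf {Sig : Type} {rank : Sig → ℕ} {k : ℕ} (A : TWA Sig rank k)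
    (t : RTree Sig rank) : Type :=
  A.Q × (Fin k → Pos t) × List (A.X × Pos t)

/-- Semantics of tests. -/
def testHolds {k : ℕ} (t : RTree Sig rank) {X : Type} (τ : TTest Sig k X)
    (hs : Fin k → Pos t) (π : List (X × Pos t)) : Prop :=
  match τ with
  | .lab i a => labelAt t (hs i).1 = some a
  | .peb i x => (x, hs i) ∈ π
  | .chno i j => childNo (hs i).1 = j

/-- Semantics of a single instruction, relating head positions and pebble stacks
before and after. -/
def instrStep {k : ℕ} (t : RTree Sig rank) {X : Type} (ins : TInstr Sig k X)
    (hs : Fin k → Pos t) (π : List (X × Pos t))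
    (hs' : Fin k → Pos t) (π' : List (X × Pos t)) : Prop :=
  match ins with
  | .up i => π' = π ∧ (∃ j : ℕ, (hs i).1 = (hs' i).1 ++ [j]) ∧ ∀ h, h ≠ i → hs' h = hs h
  | .down i j => π' = π ∧ 1 ≤ j ∧ (hs' i).1 = (hs i).1 ++ [j - 1] ∧ ∀ h, h ≠ i → hs' h = hs h
  | .dropPeb i x => hs' = hs ∧ π' = (x, hs i) :: π ∧ ∀ w, (x, w) ∉ π
  | .retrieve x => hs' = hs ∧ ∃ w, π = (x, w) :: π'
  | .test b τ => hs' = hs ∧ π' = π ∧ (testHolds t τ hs π ↔ b = true)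

/-- The step relation of automaton `A` on tree `t`. -/
def Step {k : ℕ} (A : TWA Sig rank k) (t : RTree Sig rank) :
    TConf A t → TConf A t → Prop :=
  fun c c' => ∃ ins : TInstr Sig k A.X,
    (c.1, ins, c'.1) ∈ A.instr ∧ instrStep t ins c.2.1 c.2.2 c'.2.1 c'.2.2

/-- `χ'` is the negation of the test `χ`. -/
def negOf {k : ℕ} {X : Type} (χ χ' : TInstr Sig k X) : Prop :=
  ∃ b τ, χ = TInstr.test b τ ∧ χ' = TInstr.test (!b) τ

/-- Determinism: any two distinct instructions with the same source state consist
of a test and its negation. -/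
def Deterministic {k : ℕ} (A : TWA Sig rank k) : Prop :=
  ∀ p χ₁ q₁ χ₂ q₂, (p, χ₁, q₁) ∈ A.instr → (p, χ₂, q₂) ∈ A.instr →
    (χ₁, q₁) ≠ (χ₂, q₂) → negOf χ₁ χ₂ ∨ negOf χ₂ χ₁

/-- The initial configuration: initial state, all heads at the root, no pebbles. -/
def initConf {k : ℕ} (A : TWA Sig rank k) (t : RTree Sig rank) : TConf A t :=
  (A.q0, fun _ => rootPos t, [])

/-- A configuration is halting if no step is possible from it. -/
def HaltingConf {k : ℕ} (A : TWA Sig rank k) (t : RTree Sig rank) (c : TConf A t) : Prop :=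
  ∀ c', ¬ Step A t c c'

/-- Acceptance: some computation from the initial configuration halts in an
accepting state with all heads at the root and no pebbles on the tree. -/
def Accepts {k : ℕ} (A : TWA Sig rank k) (t : RTree Sig rank) : Prop :=
  ∃ q ∈ A.acc,
    Relation.ReflTransGen (Step A t) (initConf A t) (q, fun _ => rootPos t, []) ∧
    HaltingConf A t (q, fun _ => rootPos t, [])

/-- The tree language accepted by `A`. -/
def Lang {k : ℕ} (A : TWA Sig rank k) : Set (RTree Sig rank) := {t | Accepts A t}

/-- The automaton uses no pebbles at all. -/
def PebbleFree {k : ℕ} (A : TWA Sig rank k) : Prop :=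
  ∀ p χ q, (p, χ, q) ∈ A.instr →
    (∀ i x, χ ≠ TInstr.dropPeb i x) ∧ (∀ x, χ ≠ TInstr.retrieve x) ∧
    (∀ b i x, χ ≠ TInstr.test b (TTest.peb i x))

/-- `DPTWA^k`: tree languages accepted by deterministic `k`-head tree-walking
automata with nested pebbles. -/
def DPTWA (Sig : Type) (rank : Sig → ℕ) (k : ℕ) : Set (Set (RTree Sig rank)) :=
  {L | ∃ A : TWA Sig rank k, Deterministic A ∧ L = Lang A}

/-- `NPTWA^k`: tree languages accepted by nondeterministic `k`-head tree-walking
automata with nested pebbles. -/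
def NPTWA (Sig : Type) (rank : Sig → ℕ) (k : ℕ) : Set (Set (RTree Sig rank)) :=
  {L | ∃ A : TWA Sig rank k, L = Lang A}

/-- `NTWA^k`: tree languages accepted by nondeterministic `k`-head tree-walking
automata without pebbles. -/
def NTWA (Sig : Type) (rank : Sig → ℕ) (k : ℕ) : Set (Set (RTree Sig rank)) :=
  {L | ∃ A : TWA Sig rank k, PebbleFree A ∧ L = Lang A}

end NestedPebbles

namespace NestedPebbles

/-! ### Semantic definability -/

section Definability

variable {Sig : Type} {rank : Sig → ℕ} {k : ℕ}

/-- A relation on nodes, indexed by `I`, is definable if for every choice of variables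
there is a well-formed formula with these free variables expressing it. -/
def Dfb (k : ℕ) {I : Type} (R : ∀ t : RTree Sig rank, (I → Pos t) → Prop) : Prop :=
  ∀ f : I → ℕ, ∃ φ : TForm Sig rank k, WF φ ∧ freeVars φ ⊆ Set.range f ∧
    ∀ (t : RTree Sig rank) (ν : ℕ → Pos t), Sat t φ ν ↔ R t (fun i => ν (f i))

variable {I J : Type} {R R' : ∀ t : RTree Sig rank, (I → Pos t) → Prop}

theorem Dfb.congr (h : Dfb k R) (e : ∀ t v, R' t v ↔ R t v) : Dfb k R' := by
  intro f
  obtain ⟨φ, h1, h2, h3⟩ := h f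
  exact ⟨φ, h1, h2, fun t ν => (h3 t ν).trans (e _ _).symm⟩

theorem Dfb.subst (h : Dfb k R) (g : I → J) :
    Dfb k (fun t (v : J → Pos t) => R t (fun i => v (g i))) := by
  intro f
  obtain ⟨φ, h1, h2, h3⟩ := h (f ∘ g)
  exact ⟨φ, h1, h2.trans (Set.range_comp_subset_range g f), h3⟩

theorem Dfb.not (h : Dfb k R) : Dfb k (fun t v => ¬ R t v) := by
  intro f
  obtain ⟨φ, h1, h2, h3⟩ := h f
  exact ⟨.not φ, h1, h2, fun t ν => by simp only [Sat, h3]⟩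

theorem Dfb.and (h : Dfb k R) (h' : Dfb k R') : Dfb k (fun t v => R t v ∧ R' t v) := by
  intro f
  obtain ⟨φ, h1, h2, h3⟩ := h f
  obtain ⟨ψ, g1, g2, g3⟩ := h' f
  exact ⟨.and φ ψ, ⟨h1, g1⟩, Set.union_subset h2 g2, fun t ν => by simp only [Sat, h3, g3]⟩

theorem Dfb.or (h : Dfb k R) (h' : Dfb k R') : Dfb k (fun t v => R t v ∨ R' t v) := by
  intro f
  obtain ⟨φ, h1, h2, h3⟩ := h f
  obtain ⟨ψ, g1, g2, g3⟩ := h' f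
  exact ⟨.or φ ψ, ⟨h1, g1⟩, Set.union_subset h2 g2, fun t ν => by simp only [Sat, h3, g3]⟩

theorem Dfb.const (P : Prop) : Dfb k (fun (t : RTree Sig rank) (_ : I → Pos t) => P) := by
  intro f
  by_cases hP : P
  · refine ⟨.all 0 (.eq 0 0), trivial, ?_, fun t ν => ?_⟩
    · simp [freeVars]
    · simp [Sat, hP]
  · refine ⟨.not (.all 0 (.eq 0 0)), trivial, ?_, fun t ν => ?_⟩
    · simp [freeVars]
    · simp [Sat, hP]

theorem Dfb.imp (h : Dfb k R) (h' : Dfb k R') : Dfb k (fun t v => R t v → R' t v) :=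
  (h.not.or h').congr fun t v => by tauto

theorem Dfb.iff_const (h : Dfb k R) (P : Prop) : Dfb k (fun t v => R t v ↔ P) :=
  ((h.imp (Dfb.const P)).and ((Dfb.const P).imp h)).congr fun t v => by tauto

theorem Dfb.exFin {ι : Type} {s : Set ι} (hs : s.Finite)
    {F : ι → ∀ t : RTree Sig rank, (I → Pos t) → Prop} (h : ∀ i ∈ s, Dfb k (F i)) :
    Dfb k (fun t v => ∃ i ∈ s, F i t v) := by
  induction s, hs using Set.Finite.induction_on with
  | empty => exact (Dfb.const False).congr fun t v => by simp
  | insert _ _ ih =>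
    exact ((h _ (Set.mem_insert _ _)).or
      (ih fun i hi => h i (Set.mem_insert_of_mem _ hi))).congr fun t v => by simp

theorem Dfb.exType {ι : Type} [Finite ι]
    {F : ι → ∀ t : RTree Sig rank, (I → Pos t) → Prop} (h : ∀ i, Dfb k (F i)) :
    Dfb k (fun t v => ∃ i, F i t v) :=
  (Dfb.exFin Set.finite_univ fun i _ => h i).congr fun t v => by simp

theorem Dfb.allType {ι : Type} [Finite ι]
    {F : ι → ∀ t : RTree Sig rank, (I → Pos t) → Prop} (h : ∀ i, Dfb k (F i)) :
    Dfb k (fun t v => ∀ i, F i t v) :=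
  (Dfb.exType fun i => (h i).not).not.congr fun t v => by push Not; rfl

theorem exists_fresh [Finite I] (f : I → ℕ) : ∃ N, ∀ i, f i < N := by
  obtain ⟨N, hN⟩ := (Set.finite_range f).bddAbove
  exact ⟨N + 1, fun i => Nat.lt_succ_of_le (hN ⟨i, rfl⟩)⟩

theorem Dfb.ex [Finite I] {S : ∀ t : RTree Sig rank, (Option I → Pos t) → Prop}
    (h : Dfb k S) : Dfb k (fun t (v : I → Pos t) => ∃ u, S t (fun o => o.elim u v)) := by
  intro f
  obtain ⟨N, hN⟩ := exists_fresh f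
  obtain ⟨φ, h1, h2, h3⟩ := h (fun o => o.elim N f)
  refine ⟨.ex N φ, h1, ?_, fun t ν => ?_⟩
  · rintro x ⟨hx, hxN⟩
    obtain ⟨o, rfl⟩ := h2 hx
    cases o with
    | none => exact absurd rfl hxN
    | some i => exact ⟨i, rfl⟩
  · simp only [Sat, h3]
    refine exists_congr fun u => iff_of_eq (congrArg _ (funext fun o => ?_))
    cases o with
    | none => simp
    | some i => simp [(hN i).ne]

theorem Dfb.all [Finite I] {S : ∀ t : RTree Sig rank, (Option I → Pos t) → Prop}
    (h : Dfb k S) : Dfb k (fun t (v : I → Pos t) => ∀ u, S t (fun o => o.elim u v)) :=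
  h.not.ex.not.congr fun t v => by push Not; rfl

theorem Dfb.exTuple [Finite I] (n : ℕ) {S : ∀ t : RTree Sig rank, (Fin n ⊕ I → Pos t) → Prop}
    (h : Dfb k S) :
    Dfb k (fun t (v : I → Pos t) => ∃ c : Fin n → Pos t, S t (Sum.elim c v)) := by
  induction n with
  | zero =>
    refine (h.subst (Sum.elim Fin.elim0 id : Fin 0 ⊕ I → I)).congr fun t v => ?_
    constructor
    · rintro ⟨c, hc⟩
      convert hc using 2 with o
      rcases o with o | o
      · exact o.elim0
      · rfl
    · intro hc
      refine ⟨Fin.elim0, ?_⟩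
      convert hc using 2 with o
      rcases o with o | o
      · exact o.elim0
      · rfl
  | succ n ih =>
    have h1 := h.subst (Sum.elim
      (fun i => Fin.cases (motive := fun _ => Option (Fin n ⊕ I)) none (fun j => some (.inl j)) i)
      (fun i => some (.inr i)) : Fin (n + 1) ⊕ I → Option (Fin n ⊕ I))
    refine (ih h1.ex).congr fun t v => ?_
    have key : ∀ (u : Pos t) (c : Fin n → Pos t),
        (Sum.elim (Fin.cons u c : Fin (n + 1) → Pos t) v : Fin (n + 1) ⊕ I → Pos t) =
        fun i => Option.elim (Sum.elim
          (fun i => Fin.cases (motive := fun _ => Option (Fin n ⊕ I)) none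
            (fun j => some (.inl j)) i)
          (fun i => some (.inr i)) i : Option (Fin n ⊕ I)) u (Sum.elim c v) := by
      intro u c
      funext o
      rcases o with o | o
      · refine Fin.cases ?_ (fun j => ?_) o <;> simp
      · rfl
    constructor
    · rintro ⟨c, hc⟩
      refine ⟨Fin.tail c, c 0, ?_⟩
      rw [← key, Fin.cons_self_tail]
      exact hc
    · rintro ⟨c, u, hc⟩
      exact ⟨Fin.cons u c, by rw [key]; exact hc⟩

/-! Atoms -/

theorem Dfb.lab (a : Sig) (i : I) :
    Dfb k (fun (t : RTree Sig rank) (v : I → Pos t) => labelAt t (v i).1 = some a) := fun f =>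
  ⟨.lab a (f i), trivial, by simp [freeVars], fun _ _ => Iff.rfl⟩

theorem Dfb.edg (j : ℕ) (a b : I) :
    Dfb k (fun (t : RTree Sig rank) (v : I → Pos t) =>
      1 ≤ j ∧ (v b).1 = (v a).1 ++ [j - 1]) := fun f =>
  ⟨.edg j (f a) (f b), trivial, by simp [freeVars, Set.insert_subset_iff], fun _ _ => Iff.rfl⟩

theorem Dfb.le (a b : I) :
    Dfb k (fun (t : RTree Sig rank) (v : I → Pos t) => (v a).1 <+: (v b).1) := fun f =>
  ⟨.le (f a) (f b), trivial, by simp [freeVars, Set.insert_subset_iff], fun _ _ => Iff.rfl⟩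

theorem Dfb.eq (a b : I) :
    Dfb k (fun (t : RTree Sig rank) (v : I → Pos t) => v a = v b) := fun f =>
  ⟨.eq (f a) (f b), trivial, by simp [freeVars, Set.insert_subset_iff], fun _ _ => Iff.rfl⟩

/-! Transitive closure -/

theorem updVec_apply {α : Type} {ν : ℕ → α} {xs : Fin k → ℕ} (hx : Function.Injective xs)
    (a : Fin k → α) (i : Fin k) : updVec ν xs a (xs i) = a i := by
  have h : ∃ j, xs j = xs i := ⟨i, rfl⟩
  unfold updVec
  rw [dif_pos h]
  exact congrArg a (hx h.choose_spec)

theorem updVec_of_ne {α : Type} {ν : ℕ → α} {xs : Fin k → ℕ}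
    (a : Fin k → α) {n : ℕ} (h : ∀ i, xs i ≠ n) : updVec ν xs a n = ν n := by
  unfold updVec
  rw [dif_neg]
  push Not
  exact h

/-- Conjoin trivial equations so that the listed variables occur free. -/
def addEq (l : List ℕ) (φ : TForm Sig rank k) : TForm Sig rank k :=
  l.foldr (fun x ψ => .and (.eq x x) ψ) φ

theorem WF_addEq (l : List ℕ) (φ : TForm Sig rank k) (h : WF φ) : WF (addEq l φ) := by
  induction l with
  | nil => exact h
  | cons x l ih => exact ⟨trivial, ih⟩

theorem freeVars_addEq (l : List ℕ) (φ : TForm Sig rank k) :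
    freeVars (addEq l φ) = {x | x ∈ l} ∪ freeVars φ := by
  induction l with
  | nil => simp [addEq]
  | cons x l ih =>
    change ({x, x} : Set ℕ) ∪ freeVars (addEq l φ) = _
    rw [ih]
    ext y
    simp [or_assoc]

theorem Sat_addEq (l : List ℕ) (φ : TForm Sig rank k) (t : RTree Sig rank) (ν : ℕ → Pos t) :
    Sat t (addEq l φ) ν ↔ Sat t φ ν := by
  induction l with
  | nil => rfl
  | cons x l ih =>
    change (ν x = ν x ∧ Sat t (addEq l φ) ν) ↔ _
    rw [ih]
    simp

/-- Binary relations on `k`-tuples with parameters indexed by `J`. -/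
def DfbR (k : ℕ) {J : Type}
    (M : ∀ t : RTree Sig rank, (J → Pos t) → (Fin k → Pos t) → (Fin k → Pos t) → Prop) : Prop :=
  Dfb k (fun t (v : Fin k ⊕ Fin k ⊕ J → Pos t) =>
    M t (fun j => v (.inr (.inr j))) (fun i => v (.inl i)) (fun i => v (.inr (.inl i))))

variable {M M' : ∀ t : RTree Sig rank, (J → Pos t) → (Fin k → Pos t) → (Fin k → Pos t) → Prop}

theorem DfbR.star [Finite J] (h : DfbR k M) :
    DfbR k (fun t ρ => Relation.ReflTransGen (M t ρ)) := by
  intro f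
  obtain ⟨N, hN⟩ := exists_fresh f
  let xs : Fin k → ℕ := fun i => N + i
  let ys : Fin k → ℕ := fun i => N + k + i
  have hxs : Function.Injective xs := fun i j hij => by
    apply Fin.ext; simp only [xs] at hij; omega
  have hys : Function.Injective ys := fun i j hij => by
    apply Fin.ext; simp only [ys] at hij; omega
  have hxy : ∀ i j, xs i ≠ ys j := fun i j => by
    simp only [xs, ys]; omega
  have hfx : ∀ j i, xs i ≠ f j := fun j i => by
    have := hN j; simp only [xs]; omega
  have hfy : ∀ j i, ys i ≠ f j := fun j i => by
    have := hN j; simp only [ys]; omega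
  obtain ⟨φ, h1, h2, h3⟩ := h (Sum.elim xs (Sum.elim ys (fun j => f (.inr (.inr j)))))
  refine ⟨.tc xs ys (addEq (List.ofFn xs ++ List.ofFn ys) φ)
    (fun i => f (.inl i)) (fun i => f (.inr (.inl i))), ?_, ?_, fun t ν => ?_⟩
  · refine ⟨⟨hxs, hys, hxy⟩, ?_, WF_addEq _ _ h1⟩
    rw [freeVars_addEq]
    rintro x (⟨i, rfl⟩ | ⟨i, rfl⟩) <;> left <;> simp
  · simp only [freeVars, freeVars_addEq]
    rintro x ((⟨hx, hx'⟩ | ⟨i, rfl⟩) | ⟨i, rfl⟩)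
    · rcases hx with hx | hx
      · exfalso
        apply hx'
        simpa using hx
      · obtain ⟨o, rfl⟩ := h2 hx
        rcases o with i | i | j
        · exact absurd (Or.inl ⟨i, rfl⟩) hx'
        · exact absurd (Or.inr ⟨i, rfl⟩) hx'
        · exact ⟨_, rfl⟩
    · exact ⟨_, rfl⟩
    · exact ⟨_, rfl⟩
  · simp only [Sat, Sat_addEq, h3]
    have : (fun a b : Fin k → Pos t => M t
        (fun j => updVec (updVec ν xs a) ys b
          ((Sum.elim xs (Sum.elim ys (fun j => f (.inr (.inr j)))) : Fin k ⊕ Fin k ⊕ J → ℕ)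
            (.inr (.inr j))))
        (fun i => updVec (updVec ν xs a) ys b
          ((Sum.elim xs (Sum.elim ys (fun j => f (.inr (.inr j)))) : Fin k ⊕ Fin k ⊕ J → ℕ)
            (.inl i)))
        (fun i => updVec (updVec ν xs a) ys b
          ((Sum.elim xs (Sum.elim ys (fun j => f (.inr (.inr j)))) : Fin k ⊕ Fin k ⊕ J → ℕ)
            (.inr (.inl i))))) =
        M t (fun j => ν (f (.inr (.inr j)))) := by
      funext a b
      congr 1
      · funext j
        exact (updVec_of_ne _ (hfy _)).trans (updVec_of_ne _ (hfx _))
      · funext i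
        exact (updVec_of_ne _ (fun j => (hxy i j).symm)).trans (updVec_apply hxs _ _)
      · funext i
        exact updVec_apply hys _ _
    rw [this]

theorem DfbR.comp [Finite J] (h : DfbR k M) (h' : DfbR k M') :
    DfbR k (fun t ρ a b => ∃ c, M t ρ a c ∧ M' t ρ c b) := by
  have e1 := h.subst (Sum.elim (fun i => .inr (.inl i))
    (Sum.elim (fun i => .inl i) (fun j => .inr (.inr (.inr j)))) :
      Fin k ⊕ Fin k ⊕ J → Fin k ⊕ (Fin k ⊕ Fin k ⊕ J))
  have e2 := h'.subst (Sum.elim (fun i => .inl i)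
    (Sum.elim (fun i => .inr (.inr (.inl i))) (fun j => .inr (.inr (.inr j)))) :
      Fin k ⊕ Fin k ⊕ J → Fin k ⊕ (Fin k ⊕ Fin k ⊕ J))
  exact (e1.and e2).exTuple k

theorem DfbR.eqTuple : DfbR k (fun (t : RTree Sig rank) (_ : J → Pos t) a b => a = b) := by
  refine (Dfb.allType (ι := Fin k) fun i => Dfb.eq (.inl i) (.inr (.inl i))).congr fun t v => ?_
  exact funext_iff

end Definability

/-! ### Kleene construction -/

section Kleene

/-- Nonempty paths in a labelled graph all of whose intermediate states are in `S`. -/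
inductive KPath {Q H : Type} (M : Q → Q → H → H → Prop) (S : Set Q) : Q → Q → H → H → Prop
  | single {p q a b} : M p q a b → KPath M S p q a b
  | trans {p r q a c b} : KPath M S p r a c → r ∈ S → KPath M S r q c b → KPath M S p q a b

variable {Q H : Type} {M : Q → Q → H → H → Prop}

theorem KPath.mono {S S' : Set Q} (hS : S ⊆ S') {p q a b} (h : KPath M S p q a b) :
    KPath M S' p q a b := by
  induction h with
  | single h => exact .single h
  | trans _ hr _ ih1 ih2 => exact .trans ih1 (hS hr) ih2

theorem KPath_empty {p q a b} : KPath M ∅ p q a b ↔ M p q a b := by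
  constructor
  · intro h
    cases h with
    | single h => exact h
    | trans _ hr _ => exact hr.elim
  · exact .single

theorem KPath_insert {S : Set Q} {r : Q} {p q a b} :
    KPath M (insert r S) p q a b ↔ KPath M S p q a b ∨
      ∃ c, KPath M S p r a c ∧
        ∃ d, Relation.ReflTransGen (KPath M S r r) c d ∧ KPath M S r q d b := by
  constructor
  · intro h
    induction h with
    | single h => exact .inl (.single h)
    | trans _ hs _ ih1 ih2 =>
      rcases hs with rfl | hs
      · rcases ih1 with ih1 | ⟨c, h1, d, h2, h3⟩ <;> rcases ih2 with ih2 | ⟨c', h1', d', h2', h3'⟩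
        · exact .inr ⟨_, ih1, _, .refl, ih2⟩
        · exact .inr ⟨_, ih1, _, .head h1' h2', h3'⟩
        · exact .inr ⟨_, h1, _, h2.tail h3, ih2⟩
        · exact .inr ⟨_, h1, _, (h2.tail h3).trans (.head h1' h2'), h3'⟩
      · rcases ih1 with ih1 | ⟨c, h1, d, h2, h3⟩ <;> rcases ih2 with ih2 | ⟨c', h1', d', h2', h3'⟩
        · exact .inl (ih1.trans hs ih2)
        · exact .inr ⟨_, ih1.trans hs h1', _, h2', h3'⟩
        · exact .inr ⟨_, h1, _, h2, h3.trans hs ih2⟩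
        · exact .inr ⟨_, h1, _, (h2.tail (h3.trans hs h1')).trans h2', h3'⟩
  · have hS : S ⊆ insert r S := Set.subset_insert _ _
    rintro (h | ⟨c, h1, d, h2, h3⟩)
    · exact h.mono hS
    · have : KPath M (insert r S) p r a d := by
        clear h3
        induction h2 with
        | refl => exact h1.mono hS
        | tail _ h ih => exact ih.trans (Set.mem_insert _ _) (h.mono hS)
      exact this.trans (Set.mem_insert _ _) (h3.mono hS)

theorem star_iff_KPath {p q : Q} {a b : H} :
    Relation.ReflTransGen (fun c c' : Q × H => M c.1 c'.1 c.2 c'.2) (p, a) (q, b) ↔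
      (p = q ∧ a = b) ∨ KPath M Set.univ p q a b := by
  constructor
  · intro h
    generalize hc : (q, b) = c at h
    induction h generalizing q b with
    | refl => cases hc; exact .inl ⟨rfl, rfl⟩
    | @tail c1 c2 _ h ih =>
      subst hc
      rcases ih (q := c1.1) (b := c1.2) rfl with ⟨h1, h2⟩ | h1
      · right
        rw [h1, h2]
        exact .single h
      · exact .inr (h1.trans trivial (.single h))
  · rintro (⟨rfl, rfl⟩ | h)
    · exact .refl
    · induction h with
      | single h => exact .single h
      | trans _ _ _ ih1 ih2 => exact ih1.trans ih2

variable {Sig : Type} {rank : Sig → ℕ} {k : ℕ} {J : Type}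

theorem DfbR.KPath [Finite J] {Q : Type}
    {M : ∀ t : RTree Sig rank, (J → Pos t) → Q → Q → (Fin k → Pos t) → (Fin k → Pos t) → Prop}
    (h : ∀ p q, DfbR k (fun t ρ => M t ρ p q)) {S : Set Q} (hS : S.Finite) :
    ∀ p q, DfbR k (fun t ρ => KPath (M t ρ) S p q) := by
  induction S, hS using Set.Finite.induction_on with
  | empty => exact fun p q => (h p q).congr fun t v => KPath_empty
  | @insert r S _ _ ih =>
    intro p q
    exact Dfb.congr (Dfb.or (ih p q) ((ih p r).comp ((ih r r).star.comp (ih r q))))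
      fun t v => KPath_insert

theorem DfbR.kleene [Finite J] {Q : Type} [Finite Q]
    {M : ∀ t : RTree Sig rank, (J → Pos t) → Q → Q → (Fin k → Pos t) → (Fin k → Pos t) → Prop}
    (h : ∀ p q, DfbR k (fun t ρ => M t ρ p q)) (p q : Q) :
    DfbR k (fun t ρ a b => Relation.ReflTransGen
      (fun c c' : Q × (Fin k → Pos t) => M t ρ c.1 c'.1 c.2 c'.2) (p, a) (q, b)) :=
  Dfb.congr (Dfb.or (Dfb.and (Dfb.const (p = q)) DfbR.eqTuple)
    (DfbR.KPath h Set.finite_univ p q)) fun _ _ => star_iff_KPath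

end Kleene

/-! ### Nested runs -/

section Runs

variable {Sig : Type} {rank : Sig → ℕ} {k : ℕ}

/-- Runs above a given pebble stack. -/
inductive Run (A : TWA Sig rank k) (t : RTree Sig rank) :
    List (A.X × Pos t) → A.Q → A.Q → (Fin k → Pos t) → (Fin k → Pos t) → Prop
  | refl {π p a} : Run A t π p p a a
  | step {π p q r a b c} (ins : TInstr Sig k A.X) : Run A t π p q a b →
      (q, ins, r) ∈ A.instr → instrStep t ins b π c π → Run A t π p r a c
  | peb {π p q r q' r' a b c} (i : Fin k) (x : A.X) : Run A t π p q a b →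
      (q, .dropPeb i x, q') ∈ A.instr → (∀ w, (x, w) ∉ π) →
      Run A t ((x, b i) :: π) q' r' b c → (r', .retrieve x, r) ∈ A.instr → Run A t π p r a c

/-- A large step above a fixed stack. -/
def MStep (A : TWA Sig rank k) (t : RTree Sig rank) (π : List (A.X × Pos t))
    (p q : A.Q) (a b : Fin k → Pos t) : Prop :=
  (∃ e ∈ A.instr, (e.1 = p ∧ e.2.2 = q) ∧ instrStep t e.2.1 a π b π) ∨
  (∃ (x : A.X) (i : Fin k) (p' q' : A.Q),
    ((p, TInstr.dropPeb i x, p') ∈ A.instr ∧ (q', TInstr.retrieve x, q) ∈ A.instr) ∧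
    (∀ w, (x, w) ∉ π) ∧ Run A t ((x, a i) :: π) p' q' a b)

variable {A : TWA Sig rank k} {t : RTree Sig rank}

theorem Run_iff {π : List (A.X × Pos t)} {p q : A.Q} {a b : Fin k → Pos t} :
    Run A t π p q a b ↔ Relation.ReflTransGen
      (fun c c' : A.Q × (Fin k → Pos t) => MStep A t π c.1 c'.1 c.2 c'.2) (p, a) (q, b) := by
  constructor
  · intro h
    induction h with
    | refl => exact .refl
    | step ins _ h1 h2 ih => exact ih.tail (.inl ⟨_, h1, ⟨rfl, rfl⟩, h2⟩)
    | peb i x _ h1 h2 h3 h4 ih _ => exact ih.tail (.inr ⟨x, i, _, _, ⟨h1, h4⟩, h2, h3⟩)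
  · intro h
    generalize hc : (q, b) = c at h
    induction h generalizing q b with
    | refl => cases hc; exact .refl
    | @tail c1 c2 _ h ih =>
      subst hc
      have h0 := ih (q := c1.1) (b := c1.2) rfl
      rcases h with ⟨⟨p1, ins, p2⟩, he, ⟨h1, h2⟩, h3⟩ | ⟨x, i, p', q', ⟨h1, h2⟩, h3, h4⟩
      · simp only at h1 h2 h3
        subst h1 h2
        exact .step ins h0 he h3
      · exact .peb i x h0 h1 h3 h4 h2

theorem Run.sound {π : List (A.X × Pos t)} {p q : A.Q} {a b : Fin k → Pos t}
    (h : Run A t π p q a b) : Relation.ReflTransGen (Step A t) (p, a, π) (q, b, π) := by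
  induction h with
  | refl => exact .refl
  | step ins _ h1 h2 ih => exact ih.tail ⟨ins, h1, h2⟩
  | @peb π p q r q' r' a b c i x _ h1 h2 _ h4 ih ih' =>
    have s1 : Step A t (q, b, π) (q', b, (x, b i) :: π) :=
      ⟨.dropPeb i x, h1, rfl, rfl, h2⟩
    have s2 : Step A t (r', c, (x, b i) :: π) (r, c, π) :=
      ⟨.retrieve x, h4, rfl, _, rfl⟩
    exact Relation.ReflTransGen.tail ((ih.tail s1).trans ih') s2

/-- Invariant describing reachable configurations through nested runs. -/
def Inv (A : TWA Sig rank k) (t : RTree Sig rank) (p0 : A.Q) (a0 : Fin k → Pos t) :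
    List (A.X × Pos t) → A.Q → (Fin k → Pos t) → Prop
  | [], q, a => Run A t [] p0 q a0 a
  | (x, w) :: π, q, a => ∃ p p' b, ∃ i : Fin k, Inv A t p0 a0 π p b ∧
      (p, TInstr.dropPeb i x, p') ∈ A.instr ∧ w = b i ∧ (∀ w, (x, w) ∉ π) ∧
      Run A t ((x, w) :: π) p' q b a

theorem Inv.extend {p0 : A.Q} {a0 : Fin k → Pos t} {π : List (A.X × Pos t)} {q r a b}
    (h : Inv A t p0 a0 π q a)
    (hr : ∀ p c, Run A t π p q c a → Run A t π p r c b) : Inv A t p0 a0 π r b := by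
  match π, h with
  | [], h => exact hr _ _ h
  | (x, w) :: π, ⟨p, p', c, i, h1, h2, h3, h4, h5⟩ =>
    exact ⟨p, p', c, i, h1, h2, h3, h4, hr _ _ h5⟩

theorem Inv.next {p0 : A.Q} {a0 : Fin k → Pos t} {c c' : TConf A t}
    (h : Inv A t p0 a0 c.2.2 c.1 c.2.1) (hs : Step A t c c') :
    Inv A t p0 a0 c'.2.2 c'.1 c'.2.1 := by
  obtain ⟨q, a, π⟩ := c
  obtain ⟨q', a', π'⟩ := c'
  obtain ⟨ins, hi, hs⟩ := hs
  simp only at h hi hs ⊢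
  cases ins with
  | up i =>
    obtain rfl := hs.1
    exact h.extend fun p c hr => .step _ hr hi hs
  | down i j =>
    obtain rfl := hs.1
    exact h.extend fun p c hr => .step _ hr hi hs
  | test b τ =>
    obtain rfl := hs.2.1
    exact h.extend fun p c hr => .step _ hr hi hs
  | dropPeb i x =>
    obtain ⟨rfl, rfl, hf⟩ := hs
    exact ⟨q, q', _, i, h, hi, rfl, hf, .refl⟩
  | retrieve x =>
    obtain ⟨rfl, w, rfl⟩ := hs
    obtain ⟨p, p', c, i, h1, h2, rfl, h4, h5⟩ := h
    exact h1.extend fun p c hr => .peb i x hr h2 h4 h5 hi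

theorem reach_iff_Run {p q : A.Q} {a b : Fin k → Pos t} :
    Relation.ReflTransGen (Step A t) (p, a, []) (q, b, []) ↔ Run A t [] p q a b := by
  constructor
  · intro h
    have : ∀ c, Relation.ReflTransGen (Step A t) (p, a, []) c →
        Inv A t p a c.2.2 c.1 c.2.1 := by
      intro c hc
      induction hc with
      | refl => exact Run.refl
      | tail _ hs ih => exact ih.next hs
    exact this _ h
  · exact Run.sound

end Runs

/-! ### Definability of steps -/

section Steps

variable {Sig : Type} {rank : Sig → ℕ} {k : ℕ} {I : Type}

theorem subtree_append (t : RTree Sig rank) (p q : List ℕ) :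
    t.subtree (p ++ q) = (t.subtree p).bind fun s => s.subtree q := by
  induction p generalizing t with
  | nil => simp [RTree.subtree]
  | cons i p ih =>
    simp only [List.cons_append, RTree.subtree]
    cases t.child i with
    | none => rfl
    | some s => exact ih s

theorem IsPos.of_append {t : RTree Sig rank} {p q : List ℕ} (h : IsPos t (p ++ q)) :
    IsPos t p := by
  unfold IsPos at *
  rw [subtree_append] at h
  cases hp : t.subtree p with
  | none => simp [hp] at h
  | some s => rfl

theorem isRoot_iff {t : RTree Sig rank} (u : Pos t) :
    u = rootPos t ↔ ∀ w : Pos t, u.1 <+: w.1 := by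
  constructor
  · rintro rfl w
    exact List.nil_prefix
  · intro h
    exact Subtype.ext (List.prefix_nil.1 (h (rootPos t)))

theorem Dfb.isRoot [Finite I] (i : I) :
    Dfb k (fun (t : RTree Sig rank) (v : I → Pos t) => v i = rootPos t) :=
  (Dfb.all (Dfb.le (some i) none)).congr fun t v => isRoot_iff (v i)

theorem childNo_succ (p : List ℕ) (j : ℕ) : childNo p = j + 1 ↔ ∃ q, p = q ++ [j] := by
  unfold childNo
  rcases List.eq_nil_or_concat p with rfl | ⟨q, i, rfl⟩
  · simp
  · simp

theorem childNo_zero (p : List ℕ) : childNo p = 0 ↔ p = [] := by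
  unfold childNo
  rcases List.eq_nil_or_concat p with rfl | ⟨q, i, rfl⟩
  · simp
  · simp

theorem Dfb.childNo [Finite I] (i : I) (j : ℕ) :
    Dfb k (fun (t : RTree Sig rank) (v : I → Pos t) => childNo (v i).1 = j) := by
  cases j with
  | zero =>
    refine (Dfb.isRoot i).congr fun t v => ?_
    rw [childNo_zero]
    exact ⟨fun h => Subtype.ext h, fun h => by rw [h]; rfl⟩
  | succ j =>
    refine (Dfb.ex (Dfb.edg (j + 1) none (some i))).congr fun t v => ?_
    rw [childNo_succ]
    constructor
    · rintro ⟨q, hq⟩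
      exact ⟨⟨q, IsPos.of_append (hq ▸ (v i).2)⟩, by simp, hq⟩
    · rintro ⟨u, _, hu⟩
      exact ⟨u.1, hu⟩

theorem parent_iff {t : RTree Sig rank} (x y : Pos t) :
    (∃ j, x.1 = y.1 ++ [j]) ↔
      (y.1 <+: x.1 ∧ ¬ y = x) ∧ ∀ z : Pos t, (z.1 <+: x.1 ∧ ¬ z = x) → z.1 <+: y.1 := by
  constructor
  · rintro ⟨j, hj⟩
    refine ⟨⟨⟨[j], hj.symm⟩, ?_⟩, ?_⟩
    · rintro rfl
      simp at hj
    · rintro z ⟨hz, hne⟩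
      rw [hj, List.prefix_concat_iff] at hz
      rcases hz with hz | hz
      · exact absurd (Subtype.ext (by rw [hz, hj])) hne
      · exact hz
  · rintro ⟨⟨⟨s, hs⟩, hne⟩, h⟩
    rcases List.eq_nil_or_concat s with rfl | ⟨s', j, rfl⟩
    · exact absurd (Subtype.ext (by simpa using hs)) hne
    · refine ⟨j, ?_⟩
      rw [List.concat_eq_append, ← List.append_assoc] at hs
      have hz := h ⟨y.1 ++ s', IsPos.of_append (q := [j]) (by rw [hs]; exact x.2)⟩
        ⟨⟨[j], hs⟩, fun e => by
          have := congrArg (fun u : Pos t => u.1.length) e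
          simp only at this
          rw [← hs] at this
          simp at this⟩
      have : s' = [] := by
        have := hz.length_le
        simp at this
        exact this
      rw [← hs, this, List.append_nil]

theorem Dfb.parent [Finite I] (a b : I) :
    Dfb k (fun (t : RTree Sig rank) (v : I → Pos t) => ∃ j, (v a).1 = (v b).1 ++ [j]) :=
  (((Dfb.le b a).and (Dfb.eq b a).not).and (Dfb.all
    (((Dfb.le none (some a)).and (Dfb.eq none (some a)).not).imp
      (Dfb.le none (some b))))).congr fun _ _ => parent_iff _ _

/-- The stack with pebble names `l` placed according to `ρ`. -/
def stk {X : Type} {t : RTree Sig rank} (l : List X) (ρ : X → Pos t) : List (X × Pos t) :=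
  l.map fun x => (x, ρ x)

theorem mem_stk {X : Type} {t : RTree Sig rank} {l : List X} {ρ : X → Pos t} {x : X}
    {w : Pos t} : (x, w) ∈ stk l ρ ↔ x ∈ l ∧ w = ρ x := by
  simp only [stk, List.mem_map, Prod.mk.injEq]
  constructor
  · rintro ⟨y, hy, rfl, rfl⟩
    exact ⟨hy, rfl⟩
  · rintro ⟨hx, rfl⟩
    exact ⟨x, hx, rfl, rfl⟩

theorem Dfb.rest [Finite I] (h h' : Fin k → I) (i : Fin k) :
    Dfb k (fun (t : RTree Sig rank) (v : I → Pos t) => ∀ j, j ≠ i → v (h' j) = v (h j)) :=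
  Dfb.allType fun j => (Dfb.const (j ≠ i)).imp (Dfb.eq (h' j) (h j))

theorem DfbR.instrStep {X : Type} [Finite X] (l : List X) (ins : TInstr Sig k X) :
    DfbR k (fun (t : RTree Sig rank) (ρ : X → Pos t) a b =>
      instrStep t ins a (stk l ρ) b (stk l ρ)) := by
  cases ins with
  | up i =>
    refine Dfb.congr ((Dfb.parent (.inl i) (.inr (.inl i))).and
      (Dfb.rest (fun i => .inl i) (fun i => .inr (.inl i)) i)) fun t v => ?_
    simp only [NestedPebbles.instrStep, true_and]
  | down i j =>
    refine Dfb.congr ((Dfb.edg j (.inl i) (.inr (.inl i))).and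
      (Dfb.rest (fun i => .inl i) (fun i => .inr (.inl i)) i)) fun t v => ?_
    simp only [NestedPebbles.instrStep, true_and, and_assoc]
  | dropPeb i x =>
    refine (Dfb.const False).congr fun t v => ?_
    simp only [NestedPebbles.instrStep, iff_false]
    rintro ⟨_, h, _⟩
    exact absurd (congrArg List.length h) (by simp)
  | retrieve x =>
    refine (Dfb.const False).congr fun t v => ?_
    simp only [NestedPebbles.instrStep, iff_false]
    rintro ⟨_, w, h⟩
    exact absurd (congrArg List.length h) (by simp)
  | test b τ =>
    have key : Dfb k (fun (t : RTree Sig rank) (v : Fin k ⊕ Fin k ⊕ X → Pos t) =>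
        testHolds t τ (fun i => v (.inl i)) (stk l fun j => v (.inr (.inr j)))) := by
      cases τ with
      | lab i a => exact Dfb.lab a _
      | peb i x =>
        refine ((Dfb.const (x ∈ l)).and (Dfb.eq (.inl i) (.inr (.inr x)))).congr
          fun t v => ?_
        exact mem_stk (ρ := fun j => v (.inr (.inr j)))
      | chno i j => exact Dfb.childNo _ j
    refine Dfb.congr (DfbR.eqTuple.and (key.iff_const (b = true))) fun t v => ?_
    simp only [NestedPebbles.instrStep, true_and]
    rw [eq_comm]

theorem Dfb.canStep {X : Type} [Finite X] (ins : TInstr Sig k X) :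
    Dfb k (fun (t : RTree Sig rank) (a : Fin k → Pos t) =>
      ∃ b π, NestedPebbles.instrStep t ins a ([] : List (X × Pos t)) b π) := by
  by_cases hd : ∃ i x, ins = .dropPeb i x
  · obtain ⟨i, x, rfl⟩ := hd
    refine (Dfb.const True).congr fun t v => ?_
    simp [NestedPebbles.instrStep]
  have h0 : Dfb k (fun (t : RTree Sig rank) (v : Fin k ⊕ Fin k → Pos t) =>
      NestedPebbles.instrStep t ins (fun i => v (.inr i)) ([] : List (X × Pos t))
        (fun i => v (.inl i)) []) := by
    cases ins with
    | up i =>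
      refine Dfb.congr ((Dfb.parent (.inr i) (.inl i)).and
        (Dfb.rest (fun i => .inr i) (fun i => .inl i) i)) fun t v => ?_
      simp only [NestedPebbles.instrStep, true_and]
    | down i j =>
      refine Dfb.congr ((Dfb.edg j (.inr i) (.inl i)).and
        (Dfb.rest (fun i => .inr i) (fun i => .inl i) i)) fun t v => ?_
      simp only [NestedPebbles.instrStep, true_and, and_assoc]
    | dropPeb i x => exact absurd ⟨i, x, rfl⟩ hd
    | retrieve x =>
      refine (Dfb.const False).congr fun t v => ?_
      simp [NestedPebbles.instrStep]
    | test b τ =>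
      have key : Dfb k (fun (t : RTree Sig rank) (v : Fin k ⊕ Fin k → Pos t) =>
          testHolds t τ (fun i => v (.inr i)) ([] : List (X × Pos t))) := by
        cases τ with
        | lab i a => exact Dfb.lab a _
        | peb i x => exact (Dfb.const False).congr fun t v => by simp [testHolds]
        | chno i j => exact Dfb.childNo _ j
      refine Dfb.congr ((Dfb.allType (ι := Fin k) fun i => Dfb.eq (.inl i) (.inr i)).and
        (key.iff_const (b = true))) fun t v => ?_
      simp only [NestedPebbles.instrStep, true_and, funext_iff]
  refine (h0.exTuple k).congr fun t a => ?_
  refine exists_congr fun b => ?_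
  constructor
  · rintro ⟨π, h⟩
    have : π = [] := by
      cases ins with
      | up i => exact h.1
      | down i j => exact h.1
      | dropPeb i x => exact absurd ⟨i, x, rfl⟩ hd
      | retrieve x => obtain ⟨_, w, hw⟩ := h; cases hw
      | test b τ => exact h.2.1
    subst this
    exact h
  · exact fun h => ⟨[], h⟩

theorem DfbR.run (A : TWA Sig rank k) [Finite A.X] [Finite A.Q] (n : ℕ) :
    ∀ l : List A.X, l.Nodup → Nat.card A.X ≤ l.length + n → ∀ p q : A.Q,
      DfbR k (fun (t : RTree Sig rank) (ρ : A.X → Pos t) => Run A t (stk l ρ) p q) := by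
  classical
  induction n with
  | zero =>
    intro l hl hc p q
    have hfull : ∀ x, x ∈ l := by
      have := Fintype.ofFinite A.X
      intro x
      by_contra hx
      have h1 : (x :: l).Nodup := List.nodup_cons.2 ⟨hx, hl⟩
      have h2 := h1.length_le_card
      rw [Nat.card_eq_fintype_card] at hc
      simp at h2 hc
      omega
    refine Dfb.congr (DfbR.kleene (M := fun t ρ => MStep A t (stk l ρ)) (fun p q => ?_) p q)
      fun t v => Run_iff
    refine Dfb.congr (Dfb.exFin A.instrFin fun e _ =>
      (Dfb.const (e.1 = p ∧ e.2.2 = q)).and (DfbR.instrStep l e.2.1)) fun t v => ?_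
    refine or_iff_left ?_
    rintro ⟨x, i, p', q', _, h, _⟩
    exact h _ (mem_stk.2 ⟨hfull x, rfl⟩)
  | succ n ih =>
    intro l hl hc p q
    refine Dfb.congr (DfbR.kleene (M := fun t ρ => MStep A t (stk l ρ)) (fun p q => ?_) p q)
      fun t v => Run_iff
    refine Dfb.or (Dfb.exFin A.instrFin fun e _ =>
      (Dfb.const (e.1 = p ∧ e.2.2 = q)).and (DfbR.instrStep l e.2.1)) ?_
    refine Dfb.exType fun x => Dfb.exType fun i => Dfb.exType fun p' => Dfb.exType fun q' =>
      (Dfb.const _).and ?_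
    by_cases hx : x ∈ l
    · refine (Dfb.const False).congr fun t v => ?_
      simp only [iff_false]
      rintro ⟨h, _⟩
      exact h _ (mem_stk.2 ⟨hx, rfl⟩)
    · have h1 := ih (x :: l) (List.nodup_cons.2 ⟨hx, hl⟩) (by simp; omega) p' q'
      have h2 := h1.subst (Sum.elim (fun i => .inl i) (Sum.elim (fun i => .inr (.inl i))
        (fun y => if y = x then .inl i else .inr (.inr y))) :
          Fin k ⊕ Fin k ⊕ A.X → Fin k ⊕ Fin k ⊕ A.X)
      refine h2.congr fun t v => ?_
      have e : stk (x :: l) (fun y => v (if y = x then .inl i else .inr (.inr y))) =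
          (x, v (.inl i)) :: stk l (fun y => v (.inr (.inr y))) := by
        simp only [stk, List.map_cons, if_true, List.cons.injEq, true_and]
        refine List.map_congr_left fun y hy => ?_
        rw [if_neg]
        rintro rfl
        exact hx hy
      simp only [Sum.elim_inl, Sum.elim_inr, e]
      refine and_iff_right ?_
      intro w hw
      exact hx (mem_stk.1 hw).1

theorem Dfb.accepts (A : TWA Sig rank k) :
    Dfb k (fun (t : RTree Sig rank) (_ : Empty → Pos t) => Accepts A t) := by
  have := A.finX
  have := A.finQ
  have h1 : ∀ q, Dfb k (fun (t : RTree Sig rank) (v : Option Empty → Pos t) =>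
      Run A t [] A.q0 q (fun _ => v none) (fun _ => v none)) := fun q =>
    (DfbR.run A (Nat.card A.X) [] List.nodup_nil (by simp) A.q0 q).subst (fun _ => none)
  have h2 : ∀ q, Dfb k (fun (t : RTree Sig rank) (v : Option Empty → Pos t) =>
      ∃ e ∈ A.instr, e.1 = q ∧ ∃ b π, NestedPebbles.instrStep t e.2.1 (fun _ => v none)
        ([] : List (A.X × Pos t)) b π) := fun q =>
    Dfb.exFin A.instrFin fun e _ =>
      (Dfb.const (e.1 = q)).and ((Dfb.canStep e.2.1).subst (fun _ => none))
  refine (Dfb.exType fun q => (Dfb.const (q ∈ A.acc)).and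
    (Dfb.ex ((Dfb.isRoot none).and ((h1 q).and (h2 q).not)))).congr fun t v => ?_
  unfold Accepts initConf
  refine exists_congr fun q => and_congr_right fun _ => ?_
  rw [reach_iff_Run]
  have e : HaltingConf A t (q, fun _ => rootPos t, []) ↔
      ¬ ∃ e ∈ A.instr, e.1 = q ∧ ∃ b π, NestedPebbles.instrStep t e.2.1 (fun _ => rootPos t)
        ([] : List (A.X × Pos t)) b π := by
    constructor
    · rintro h ⟨⟨p, ins, r⟩, he, rfl, b, π, hs⟩
      exact h (r, b, π) ⟨ins, he, hs⟩
    · rintro h ⟨r, b, π⟩ ⟨ins, he, hs⟩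
      exact h ⟨_, he, rfl, b, π, hs⟩
  rw [e]
  constructor
  · rintro ⟨h, h'⟩
    exact ⟨rootPos t, rfl, h, h'⟩
  · rintro ⟨u, hu, h, h'⟩
    simp only [Option.elim_none] at hu h h'
    subst hu
    exact ⟨h, h'⟩

end Steps

end NestedPebbles

namespace NestedPebbles

/-- `NPTWA^k ⊆ FO+TC^k`: every tree language accepted by a
nondeterministic `k`-head tree-walking automaton with nested pebbles is definable
in first-order logic with `k`-ary transitive closure. -/
theorem NPTWA_subset_FOTC (Sig : Type) [Fintype Sig] (rank : Sig → ℕ)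
    (k : ℕ) (hk : 1 ≤ k) :
    NPTWA Sig rank k ⊆ FOTC Sig rank k := by
  rintro L ⟨A, rfl⟩
  obtain ⟨φ, h1, h2, h3⟩ := Dfb.accepts A (fun e => e.elim)
  refine ⟨φ, h1, ?_, ?_⟩
  · exact Set.subset_empty_iff.1 (h2.trans (by rintro x ⟨e, _⟩; exact e.elim))
  · ext t
    exact (h3 t _).symm

end NestedPebbles
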